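/- arXiv:2305.05804 — 2 statements merged into one kernel-verified Lean document; each statement's English description precedes it below -/
import Mathlib

section
/- Let (X, d_X) and (Y, d_Y) be metric spaces and equip X × Y with the Euclidean product metric d((x,t),(y,s)) = sqrt(d_X(x,y)² + d_Y(t,s)²). Let N ∈ ℕ, and for 1 ≤ i ≤ N let g_i : X → ℝ be Lipschitz and h_i : Y → ℝ be Lipschitz. Define f : X × Y → ℝ by f(x,t) = Σ_{i=1}^N h_i(t)·g_i(x). Then for every (x,t) ∈ X × Y, lip_{X×Y}(f)(x,t)² ≤ 4·( lip_X(f(·,t))(x)² + lip_Y(f(x,·))(t)² ). -/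
open Filter Metric Topology ENNReal NNReal

/-- The local (pointwise) Lipschitz constant of `u : Z → ℝ` at `z`, valued in `ℝ≥0∞`:
`limsup_{w → z, w ≠ z} |u w - u z| / dist w z`.  At an isolated point the punctured
neighbourhood filter is trivial and the limsup is `0`. -/
noncomputable def lipConst {Z : Type*} [PseudoMetricSpace Z] (u : Z → ℝ) (z : Z) : ℝ≥0∞ :=
  Filter.limsup (fun w => ENNReal.ofReal (|u w - u z| / dist w z)) (𝓝[≠] z)

theorem eventually_abs_sub_le_of_lipConst_lt {Z : Type*} [MetricSpace Z] {u : Z → ℝ} {z : Z}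
    {c : ℝ≥0} (hc : lipConst u z < c) :
    ∀ᶠ w in 𝓝 z, |u w - u z| ≤ c * dist w z := by
  have H := eventually_nhdsWithin_iff.1 (Filter.eventually_lt_of_limsup_lt hc)
  filter_upwards [H] with w hw
  obtain rfl | hwz := eq_or_ne w z
  · simp
  have h2 := (hw hwz).le
  rw [← ENNReal.ofReal_coe_nnreal, ENNReal.ofReal_le_ofReal_iff c.coe_nonneg] at h2
  exact (div_le_iff₀ (dist_pos.2 hwz)).1 h2

theorem lipConst_le_of_eventually {Z : Type*} [PseudoMetricSpace Z] {u : Z → ℝ} {z : Z}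
    {c : ℝ≥0} (hc : ∀ᶠ w in 𝓝 z, |u w - u z| ≤ c * dist w z) : lipConst u z ≤ c := by
  refine Filter.limsup_le_of_le (h := ?_)
  filter_upwards [hc.filter_mono nhdsWithin_le_nhds] with w hw
  rw [← ENNReal.ofReal_coe_nnreal]
  exact ENNReal.ofReal_le_ofReal (div_le_of_le_mul₀ dist_nonneg c.coe_nonneg hw)

/-- If the mixed second difference of `f` at `(x, t)` is at most `C * dist y x * dist s t`, then
the local Lipschitz constant of `f` is at most the sum of those of its two slices. -/
theorem lipConst_prod_le_add {X Y : Type*} [MetricSpace X] [MetricSpace Y] {f : X × Y → ℝ}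
    {x : X} {t : Y} {C : ℝ}
    (hC : ∀ y s, |f (y, s) - f (y, t) - f (x, s) + f (x, t)| ≤ C * dist y x * dist s t) :
    lipConst (fun p : WithLp 2 (X × Y) => f (WithLp.equiv 2 (X × Y) p))
        ((WithLp.equiv 2 (X × Y)).symm (x, t))
      ≤ lipConst (fun y => f (y, t)) x + lipConst (fun s => f (x, s)) t := by
  refine ENNReal.le_of_forall_pos_le_add fun ε hε hfin => ?_
  obtain ⟨hA, hB⟩ := ENNReal.add_lt_top.1 hfin
  lift lipConst (fun y => f (y, t)) x to ℝ≥0 using hA.ne with a ha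
  lift lipConst (fun s => f (x, s)) t to ℝ≥0 using hB.ne with b hb
  have hε3 : 0 < ε / 3 := by positivity
  have h1 : ∀ᶠ y in 𝓝 x, |f (y, t) - f (x, t)| ≤ (a + ε / 3 : ℝ≥0) * dist y x :=
    eventually_abs_sub_le_of_lipConst_lt (u := fun y => f (y, t))
      (by rw [← ha]; exact_mod_cast lt_add_of_pos_right a hε3)
  have h2 : ∀ᶠ s in 𝓝 t, |f (x, s) - f (x, t)| ≤ (b + ε / 3 : ℝ≥0) * dist s t :=
    eventually_abs_sub_le_of_lipConst_lt (u := fun s => f (x, s))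
      (by rw [← hb]; exact_mod_cast lt_add_of_pos_right b hε3)
  have h3 : ∀ᶠ y in 𝓝 x, C * dist y x < (ε / 3 : ℝ≥0) := by
    have hcont : Continuous fun y => C * dist y x := by fun_prop
    refine hcont.continuousAt.eventually_lt_const ?_
    simpa using hε
  set z : WithLp 2 (X × Y) := (WithLp.equiv 2 (X × Y)).symm (x, t)
  have hfst : Tendsto (fun p : WithLp 2 (X × Y) => p.fst) (𝓝 z) (𝓝 x) :=
    (continuous_fst.comp (WithLp.prod_continuous_ofLp 2 X Y)).tendsto z
  have hsnd : Tendsto (fun p : WithLp 2 (X × Y) => p.snd) (𝓝 z) (𝓝 t) :=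
    (continuous_snd.comp (WithLp.prod_continuous_ofLp 2 X Y)).tendsto z
  have key : lipConst (fun p : WithLp 2 (X × Y) => f (WithLp.equiv 2 (X × Y) p)) z
      ≤ (a + b + ε : ℝ≥0) := by
    refine lipConst_le_of_eventually ?_
    filter_upwards [hfst.eventually h1, hsnd.eventually h2, hfst.eventually h3] with p k1 k2 k3
    have d1 : dist p.fst x ≤ dist p z := WithLp.dist_fst_le p z
    have d2 : dist p.snd t ≤ dist p z := WithLp.dist_snd_le p z
    have k4 := hC p.fst p.snd
    have k5 := mul_le_mul_of_nonneg_right k3.le (dist_nonneg (x := p.snd) (y := t))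
    change |f (p.fst, p.snd) - f (x, t)| ≤ _
    have e1 := mul_le_mul_of_nonneg_left d1 (a + ε / 3 : ℝ≥0).coe_nonneg
    have e2 := mul_le_mul_of_nonneg_left d2 (b + ε / 3 : ℝ≥0).coe_nonneg
    have e3 := mul_le_mul_of_nonneg_left d2 (ε / 3 : ℝ≥0).coe_nonneg
    push_cast at *
    rw [abs_le] at *
    constructor <;> linarith [k1.1, k1.2, k2.1, k2.2, k4.1, k4.2]
  exact_mod_cast key

theorem ENNReal.add_sq_le_four_mul (a b : ℝ≥0∞) : (a + b) ^ 2 ≤ 4 * (a ^ 2 + b ^ 2) := by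
  wlog hab : a ≤ b generalizing a b
  · rw [add_comm a, add_comm (a ^ 2)]
    exact this b a (le_of_not_ge hab)
  calc (a + b) ^ 2 ≤ (b + b) ^ 2 := by gcongr
    _ = 4 * b ^ 2 := by ring
    _ ≤ 4 * (a ^ 2 + b ^ 2) := by gcongr; exact le_add_self

theorem abs_sum_mul_mixed_difference_le {X Y : Type*} [MetricSpace X] [MetricSpace Y] {N : ℕ}
    {g : Fin N → X → ℝ} {h : Fin N → Y → ℝ} {Kg Kh : Fin N → ℝ≥0}
    (hg : ∀ i, LipschitzWith (Kg i) (g i)) (hh : ∀ i, LipschitzWith (Kh i) (h i))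
    (x y : X) (t s : Y) :
    |∑ i, h i s * g i y - ∑ i, h i t * g i y - ∑ i, h i s * g i x + ∑ i, h i t * g i x|
      ≤ (∑ i, (Kh i * Kg i : ℝ)) * dist y x * dist s t := by
  have hsum : ∑ i, h i s * g i y - ∑ i, h i t * g i y - ∑ i, h i s * g i x + ∑ i, h i t * g i x
      = ∑ i, (h i s - h i t) * (g i y - g i x) := by
    rw [← Finset.sum_sub_distrib, ← Finset.sum_sub_distrib, ← Finset.sum_add_distrib]
    exact Finset.sum_congr rfl fun i _ => by ring
  rw [hsum, Finset.sum_mul, Finset.sum_mul]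
  refine (Finset.abs_sum_le_sum_abs _ _).trans (Finset.sum_le_sum fun i _ => ?_)
  have h1 : |h i s - h i t| ≤ Kh i * dist s t := (hh i).dist_le_mul s t
  have h2 : |g i y - g i x| ≤ Kg i * dist y x := (hg i).dist_le_mul y x
  calc |(h i s - h i t) * (g i y - g i x)| = |h i s - h i t| * |g i y - g i x| := abs_mul _ _
    _ ≤ (Kh i * dist s t) * (Kg i * dist y x) := by gcongr
    _ = Kh i * Kg i * dist y x * dist s t := by ring

/-- For `f(x,t) = ∑_{i=1}^N h_i(t) g_i(x)` with `g_i, h_i` Lipschitz, the local Lipschitz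
constant of `f` on `X × Y` (with the Euclidean product metric, modelled by `WithLp 2 (X × Y)`)
satisfies `lip_{X×Y}(f)(x,t)² ≤ 4 (lip_X(f(·,t))(x)² + lip_Y(f(x,·))(t)²)`. -/
theorem lipConst_prod_sq_le
    {X Y : Type*} [MetricSpace X] [MetricSpace Y] (N : ℕ)
    (g : Fin N → X → ℝ) (h : Fin N → Y → ℝ)
    (Kg Kh : Fin N → ℝ≥0)
    (hg : ∀ i, LipschitzWith (Kg i) (g i)) (hh : ∀ i, LipschitzWith (Kh i) (h i))
    (f : X × Y → ℝ) (hf : ∀ x t, f (x, t) = ∑ i, h i t * g i x) :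
    ∀ (x : X) (t : Y),
      (lipConst (fun p : WithLp 2 (X × Y) => f (WithLp.equiv 2 (X × Y) p))
          ((WithLp.equiv 2 (X × Y)).symm (x, t))) ^ 2
        ≤ 4 * ((lipConst (fun y => f (y, t)) x) ^ 2 + (lipConst (fun s => f (x, s)) t) ^ 2) := by
  intro x t
  refine (pow_le_pow_left' (lipConst_prod_le_add (C := ∑ i, (Kh i * Kg i : ℝ)) fun y s => ?_)
    2).trans (ENNReal.add_sq_le_four_mul _ _)
  simp only [hf]
  exact abs_sum_mul_mixed_difference_le hg hh x y t s
end

section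
/- Let (Y, d, m) be a complete separable metric space equipped with a Borel measure m that is finite on bounded sets, has full support (supp m = Y), and is measure doubling with constant D, i.e. m(B(t, 2r)) ≤ D·m(B(t, r)) for all t ∈ Y and r > 0. Then for every integer k ≥ 1 there exist a countable index set I_k, a family of open subsets Q_{i,k} ⊆ Y and points t_{i,k} ∈ Y (i ∈ I_k) such that: (1) m(Y \ ⋃_{i ∈ I_k} Q_{i,k}) = 0; (2) for every i, j ∈ I_k with i ≠ j, Q_{i,k} ∩ Q_{j,k} = ∅; (3) if i ≠ j then d(t_{i,k}, t_{j,k}) > 1/k; (4) B(t_{i,k}, 1/(3k)) ⊆ Q_{i,k} ⊆ B(t_{i,k}, 5/(4k)) for every i ∈ I_k. -/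
open MeasureTheory Metric ENNReal NNReal

open Set

/-- All but countably many spheres around a point are null, so some radius in any interval
gives a null sphere. -/
theorem exists_measure_sphere_eq_zero {Y : Type*} [PseudoMetricSpace Y] [MeasurableSpace Y]
    [OpensMeasurableSpace Y] (m : Measure Y) [SFinite m] (x : Y) {a b : ℝ} (hab : a < b) :
    ∃ r ∈ Ioo a b, m (sphere x r) = 0 := by
  have hc : {r : ℝ | 0 < m (sphere x r)}.Countable :=
    Measure.countable_meas_pos_of_disjoint_iUnion (fun r => isClosed_sphere.measurableSet)
      fun r s hrs => disjoint_left.2 fun y hr hs => hrs (hr.symm.trans hs)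
  obtain ⟨r, hr, hr0⟩ := (hc.dense_compl ℝ).exists_between hab
  exact ⟨r, hr0, by simpa using hr⟩

/-- A separable metric space contains a countable maximal `c`-separated family. -/
theorem exists_separated_net {Y : Type*} [MetricSpace Y] [TopologicalSpace.SeparableSpace Y]
    {c : ℝ} (hc : 0 < c) :
    ∃ (I : Set ℕ) (t : I → Y), (∀ i j, i ≠ j → c < dist (t i) (t j)) ∧
      ∀ y, ∃ i, dist y (t i) ≤ c := by
  lift c to ℝ≥0 using hc.le
  obtain ⟨S, hS⟩ : ∃ S : Set Y, Maximal (fun N ↦ N ⊆ univ ∧ IsSeparated c N) S := by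
    refine zorn_subset _ fun C hC hchain => ⟨⋃₀ C, ⟨subset_univ _, ?_⟩,
      fun s hs => subset_sUnion_of_mem hs⟩
    exact (pairwise_sUnion hchain.directedOn).2 fun s hs => (hC hs).2
  have hsep : ∀ x y : S, x ≠ y → (c : ℝ) < dist (x : Y) y := fun x y hxy => by
    have h : (c : ℝ≥0∞) < edist (x : Y) y := hS.prop.2 x.2 y.2 (Subtype.coe_ne_coe.2 hxy)
    rw [edist_nndist] at h
    exact_mod_cast h
  have : Countable S := by
    refine Pairwise.countable_of_isOpen_disjoint (s := fun x : S => ball (x : Y) (c / 2))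
      (fun x y hxy => ball_disjoint_ball ?_) (fun _ => isOpen_ball)
      fun x => ⟨x, mem_ball_self (half_pos hc)⟩
    linarith [hsep x y hxy]
  obtain ⟨f, hf⟩ := exists_injective_nat S
  let e := Equiv.ofInjective f hf
  refine ⟨range f, fun i => e.symm i, fun i j hij => hsep _ _ (e.symm.injective.ne hij),
    fun y => ?_⟩
  obtain ⟨x, hx, hyx⟩ := mem_iUnion₂.1
    (isCover_iff_subset_iUnion_closedBall.1 (IsCover.of_maximal_isSeparated hS) (mem_univ y))
  exact ⟨e ⟨x, hx⟩, by simpa using hyx⟩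

/-- Small closed balls around the points of a `c`-separated family are locally finite. -/
theorem locallyFinite_closedBall_of_separated {Y ι : Type*} [PseudoMetricSpace Y]
    {t : ι → Y} {s : ι → ℝ} {c b : ℝ} (ht : ∀ i j, i ≠ j → c < dist (t i) (t j))
    (hs : ∀ i, s i ≤ b) (hb : 2 * b < c) :
    LocallyFinite fun i => closedBall (t i) (s i) := by
  intro y
  refine ⟨ball y (c / 2 - b), ball_mem_nhds y (by linarith), Subsingleton.finite ?_⟩
  rintro i ⟨u, hui, huy⟩ j ⟨v, hvj, hvy⟩
  by_contra hij
  rw [mem_closedBall'] at hui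
  rw [mem_closedBall] at hvj
  rw [mem_ball] at huy
  rw [mem_ball'] at hvy
  linarith [ht i j hij, dist_triangle4 (t i) u v (t j), dist_triangle u y v, hs i, hs j]

/-- Given a countable separated net `t` with null inner spheres of radius `s i` and null outer
spheres of radius `r i`, the outer balls can be cut down to disjoint open sets that still contain
the inner balls and cover almost everything. -/
theorem exists_disjoint_open_between_balls {Y : Type*} [PseudoMetricSpace Y] [MeasurableSpace Y]
    (m : Measure Y) {I : Set ℕ} {t : I → Y} {s r : I → ℝ} {c b : ℝ}
    (ht : ∀ i j, i ≠ j → c < dist (t i) (t j)) (hcov : ∀ y, ∃ i, dist y (t i) ≤ c)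
    (hs : ∀ i, s i ≤ b) (hb : 2 * b < c) (hbc : b ≤ c) (hr : ∀ i, c < r i)
    (hs0 : ∀ i, m (sphere (t i) (s i)) = 0) (hr0 : ∀ i, m (sphere (t i) (r i)) = 0) :
    ∃ Q : I → Set Y, (∀ i, IsOpen (Q i)) ∧ m (univ \ ⋃ i, Q i) = 0 ∧
      (∀ i j, i ≠ j → Q i ∩ Q j = ∅) ∧
      ∀ i, ball (t i) (s i) ⊆ Q i ∧ Q i ⊆ ball (t i) (r i) := by
  set U : Set Y := ⋃ i, closedBall (t i) (s i) with hU
  have hUc : IsClosed U :=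
    (locallyFinite_closedBall_of_separated ht hs hb).isClosed_iUnion fun _ => isClosed_closedBall
  have hsU : ∀ i, ball (t i) (s i) ⊆ U := fun i =>
    ball_subset_closedBall.trans (subset_iUnion (fun i => closedBall (t i) (s i)) i)
  let V : I → Set Y := fun i =>
    ball (t i) (r i) \ (U ∪ ⋃ j ∈ {j : I | j < i}, closedBall (t j) (r j))
  have hVU : ∀ i, Disjoint (V i) U := fun i => disjoint_left.2 fun y hy hyU => hy.2 (Or.inl hyU)
  have hVlt : ∀ i j, i < j → Disjoint (V i) (V j) := fun i j hij =>
    disjoint_left.2 fun y hi hj =>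
      hj.2 (Or.inr (mem_iUnion₂.2 ⟨i, hij, ball_subset_closedBall hi.1⟩))
  refine ⟨fun i => ball (t i) (s i) ∪ V i, fun i => ?_, ?_, fun i j hij => ?_, fun i => ?_⟩
  · have hfin : {j : I | j < i}.Finite :=
      ((finite_lt_nat (i : ℕ)).preimage Subtype.val_injective.injOn).subset fun j hj => hj
    exact isOpen_ball.union <| isOpen_ball.sdiff <| hUc.union <|
      hfin.isClosed_biUnion fun _ _ => isClosed_closedBall
  · refine measure_mono_null (t := ⋃ i, (sphere (t i) (s i) ∪ sphere (t i) (r i))) ?_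
      (measure_iUnion_null fun i => measure_union_null (hs0 i) (hr0 i))
    rintro y ⟨-, hy⟩
    by_contra hns
    simp only [mem_iUnion, mem_union, not_exists, not_or, mem_sphere, mem_ball] at hy hns
    have hyU : y ∉ U := fun h => by
      obtain ⟨i, hi⟩ := mem_iUnion.1 h
      exact (hy i).1 (lt_of_le_of_ne hi (hns i).1)
    obtain ⟨i₀, hi₀⟩ := hcov y
    obtain ⟨i, hi, hmin⟩ := wellFounded_lt.has_min {i : I | dist y (t i) < r i}
      ⟨i₀, hi₀.trans_lt (hr i₀)⟩
    refine (hy i).2 ⟨hi, ?_⟩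
    rintro (h | h)
    · exact hyU h
    · obtain ⟨j, hj, hyj⟩ := mem_iUnion₂.1 h
      exact hmin j (lt_of_le_of_ne hyj (hns j).2) hj
  · have hball : Disjoint (ball (t i) (s i)) (ball (t j) (s j)) :=
      ball_disjoint_ball (by linarith [ht i j hij, hs i, hs j])
    have hVV : Disjoint (V i) (V j) :=
      (lt_or_gt_of_ne hij).elim (hVlt i j) fun h => (hVlt j i h).symm
    rw [← disjoint_iff_inter_eq_empty, disjoint_union_left, disjoint_union_right,
      disjoint_union_right]
    exact ⟨⟨hball, ((hVU j).mono_right (hsU i)).symm⟩, (hVU i).mono_right (hsU j), hVV⟩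
  · exact ⟨subset_union_left, union_subset
      (ball_subset_ball (((hs i).trans hbc).trans (hr i).le)) sdiff_subset⟩

/-- **Existence of "dyadic cubes" at scale `1/k`.**
If `(Y, d, m)` is a complete separable metric space with a Borel measure `m` that is finite on
bounded sets, has full support, and is doubling with constant `D`, then for every `k ≥ 1` there
is a countable family of pairwise disjoint open sets `Q i` with centers `t i`, covering `Y` up
to an `m`-null set, with centers `1/k`-separated and
`B(t i, 1/(3k)) ⊆ Q i ⊆ B(t i, 5/(4k))`. -/
theorem exists_dyadic_cubes
    {Y : Type*} [MetricSpace Y] [CompleteSpace Y] [TopologicalSpace.SeparableSpace Y]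
    [MeasurableSpace Y] [BorelSpace Y]
    (m : Measure Y) (D : ℝ≥0)
    (hbdd : ∀ s : Set Y, Bornology.IsBounded s → m s < ⊤)
    (hsupp : ∀ (t : Y) (r : ℝ), 0 < r → 0 < m (ball t r))
    (hdoub : ∀ (t : Y) (r : ℝ), 0 < r → m (ball t (2 * r)) ≤ (D : ℝ≥0∞) * m (ball t r)) :
    ∀ k : ℕ, 1 ≤ k →
      ∃ (I : Type) (_ : Countable I) (Q : I → Set Y) (t : I → Y),
        (∀ i, IsOpen (Q i)) ∧
        m (Set.univ \ ⋃ i, Q i) = 0 ∧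
        (∀ i j, i ≠ j → Q i ∩ Q j = ∅) ∧
        (∀ i j, i ≠ j → 1 / (k : ℝ) < dist (t i) (t j)) ∧
        (∀ i, ball (t i) (1 / (3 * (k : ℝ))) ⊆ Q i ∧ Q i ⊆ ball (t i) (5 / (4 * (k : ℝ)))) := by
  intro k hk
  have hc : (0 : ℝ) < 1 / k := by positivity
  set c : ℝ := 1 / k with hck
  have hinner : 1 / (3 * (k : ℝ)) = c / 3 := by rw [hck]; ring
  have houter : 5 / (4 * (k : ℝ)) = 5 / 4 * c := by rw [hck]; ring
  rw [hinner, houter]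
  have : SecondCountableTopology Y := UniformSpace.secondCountable_of_separable Y
  have : IsLocallyFiniteMeasure m :=
    ⟨fun x => ⟨ball x 1, ball_mem_nhds x one_pos, hbdd _ isBounded_ball⟩⟩
  obtain ⟨I, t, ht, hcov⟩ := exists_separated_net (Y := Y) hc
  choose s hs hs0 using fun i =>
    exists_measure_sphere_eq_zero m (t i) (show c / 3 < 5 / 12 * c by linarith)
  choose r hr hr0 using fun i =>
    exists_measure_sphere_eq_zero m (t i) (show c < 5 / 4 * c by linarith)
  obtain ⟨Q, hQo, hQ0, hQd, hQ⟩ := exists_disjoint_open_between_balls m ht hcov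
    (fun i => (hs i).2.le) (by linarith) (by linarith) (fun i => (hr i).1) hs0 hr0
  exact ⟨I, inferInstance, Q, t, hQo, hQ0, hQd, ht, fun i =>
    ⟨(ball_subset_ball (hs i).1.le).trans (hQ i).1,
      (hQ i).2.trans (ball_subset_ball (hr i).2.le)⟩⟩
end
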